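/- arXiv:1004.2908 — 2 statements merged into one kernel-verified Lean document; each statement's English description precedes it below -/
import Mathlib

section
/- Let H be a digraph and let S be the set of strong components of H^+ that are neither special nor co-special. Then |S| is even, say |S| = 2k, and S can be enumerated as C_1, C_2, ..., C_{2k} so that: (i) for each i with 1 ≤ i ≤ 2k, the coupled component of C_i is C_{2k+1−i}; and (ii) whenever H^+ has an arc from a vertex of C_i to a vertex of C_j with C_i ≠ C_j, we have i < j. -/
variable {V : Type*}

/-- A `+` arc of the pair digraph `H⁺`: from `(u,v)` to `(u',v')` when
`uu' ∈ E`, `vv' ∈ E` and `uv' ∉ E`. -/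
def PlusArc (E : V → V → Prop) (p q : V × V) : Prop :=
  E p.1 q.1 ∧ E p.2 q.2 ∧ ¬ E p.1 q.2

/-- A `−` arc of the pair digraph `H⁺`: from `(u,v)` to `(u',v')` when
`u'u ∈ E`, `v'v ∈ E` and `v'u ∉ E`. -/
def MinusArc (E : V → V → Prop) (p q : V × V) : Prop :=
  E q.1 p.1 ∧ E q.2 p.2 ∧ ¬ E q.2 p.1

/-- The arc relation of the pair digraph `H⁺`. -/
def HPlusArc (E : V → V → Prop) (p q : V × V) : Prop :=
  PlusArc E p q ∨ MinusArc E p q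

/-- Two vertices lie in the same strong component: each is reachable from the other. -/
def InSameSCC {α : Type*} (R : α → α → Prop) (a b : α) : Prop :=
  Relation.ReflTransGen R a b ∧ Relation.ReflTransGen R b a

/-- `C` is a strong component of the digraph with arc relation `R`. -/
def IsSCC {α : Type*} (R : α → α → Prop) (C : Set α) : Prop :=
  ∃ a, C = {b | InSameSCC R a b}

/-- A vertex `(x,y)` of `H⁺` is special if there is a directed walk in `H⁺`
from `(x,y)` to `(y,x)`. -/
def SpecialVertex (E : V → V → Prop) (p : V × V) : Prop :=
  Relation.ReflTransGen (HPlusArc E) p (p.2, p.1)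

/-- The coupled set `C' = {(u,v) : (v,u) ∈ C}`. -/
def CoupledSet (C : Set (V × V)) : Set (V × V) := {p | (p.2, p.1) ∈ C}

/-- A set of vertices of `H⁺` is special if all its vertices are special. -/
def SpecialComp (E : V → V → Prop) (C : Set (V × V)) : Prop :=
  ∀ p ∈ C, SpecialVertex E p

/-- `C` is co-special if its coupled component `C'` is special. -/
def CoSpecialComp (E : V → V → Prop) (C : Set (V × V)) : Prop :=
  SpecialComp E (CoupledSet C)

theorem list_sort_aux {β : Type*} [DecidableEq β] (r : β → β → Prop) (f : β → ℕ) (σ : β → β)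
    (hσ : ∀ a, σ (σ a) = a) :
    ∀ (n : ℕ) (S : Finset β), S.card = n → (∀ a ∈ S, σ a ∈ S) → (∀ a ∈ S, σ a ≠ a) →
      (∀ a ∈ S, ∀ b ∈ S, r a b → f a < f b) →
      (∀ a ∈ S, ∀ b ∈ S, r a b → r (σ b) (σ a)) →
      ∃ (k : ℕ) (l : List β), l.length = 2 * k ∧ l.Nodup ∧ (∀ a, a ∈ l ↔ a ∈ S) ∧
        l.map σ = l.reverse ∧ l.Pairwise (fun a b => ¬ r b a) := by
  intro n
  induction n using Nat.strong_induction_on with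
  | _ n ih =>
  intro S hn hS hfix hf hr
  rcases S.eq_empty_or_nonempty with rfl | hne
  · exact ⟨0, [], by simp⟩
  obtain ⟨x, hx, hmin⟩ := S.exists_min_image f hne
  have hxs := hS x hx
  have hnx : ∀ y ∈ S, ¬ r y x := fun y hy h => absurd (hf y hy x hx h) (not_lt.2 (hmin y hy))
  have hns : ∀ y ∈ S, ¬ r (σ x) y := by
    intro y hy h
    have := hr _ hxs _ hy h
    rw [hσ] at this
    exact hnx _ (hS y hy) this
  have hfx := hfix x hx
  obtain ⟨k, l, hlen, hnd, hmem, hmap, hpw⟩ := ih ((S.erase x).erase (σ x)).card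
    (by rw [← hn]
        exact (Finset.card_le_card (Finset.erase_subset _ _)).trans_lt
          (Finset.card_erase_lt_of_mem hx))
    ((S.erase x).erase (σ x)) rfl
    (by intro a ha
        simp only [Finset.mem_erase] at ha ⊢
        refine ⟨fun h => ha.2.1 ?_, fun h => ha.1 ?_, hS a ha.2.2⟩
        · rw [← hσ a, h, hσ]
        · rw [← h, hσ])
    (by intro a ha; simp only [Finset.mem_erase] at ha; exact hfix a ha.2.2)
    (by intro a ha b hb
        simp only [Finset.mem_erase] at ha hb; exact hf a ha.2.2 b hb.2.2)
    (by intro a ha b hb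
        simp only [Finset.mem_erase] at ha hb; exact hr a ha.2.2 b hb.2.2)
  simp only [Finset.mem_erase] at hmem
  have hlS : ∀ a ∈ l, a ∈ S := fun a ha => ((hmem a).1 ha).2.2
  have hxl : x ∉ l := fun h => ((hmem x).1 h).2.1 rfl
  have hsl : σ x ∉ l := fun h => ((hmem _).1 h).1 rfl
  refine ⟨k + 1, x :: (l ++ [σ x]), ?_, ?_, ?_, ?_, ?_⟩
  · simp [hlen]; ring
  · simp only [List.nodup_cons, List.mem_append, List.mem_singleton, List.nodup_append]
    refine ⟨?_, hnd, by simp, ?_⟩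
    · rintro (h | h)
      · exact hxl h
      · exact hfx h.symm
    · rintro a ha b rfl rfl
      exact hsl ha
  · intro a
    simp only [List.mem_cons, List.mem_append, hmem, List.not_mem_nil, or_false]
    constructor
    · rintro (rfl | h | rfl)
      · exact hx
      · exact h.2.2
      · exact hxs
    · intro h
      by_cases h1 : a = x
      · exact Or.inl h1
      · by_cases h2 : a = σ x
        · exact Or.inr (Or.inr h2)
        · exact Or.inr (Or.inl ⟨h2, h1, h⟩)
  · simp [hmap, hσ]
  · rw [List.pairwise_cons, List.pairwise_append]
    refine ⟨?_, hpw, by simp, ?_⟩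
    · intro a ha
      simp only [List.mem_append, List.mem_singleton] at ha
      rcases ha with h | rfl
      · exact hnx _ (hlS a h)
      · exact hnx _ hxs
    · intro a ha b hb
      simp only [List.mem_singleton] at hb
      subst hb
      exact hns _ (hlS a ha)

theorem hplus_skew (E : V → V → Prop) {p q : V × V} (h : HPlusArc E p q) :
    HPlusArc E q.swap p.swap := by
  rcases h with ⟨h1, h2, h3⟩ | ⟨h1, h2, h3⟩
  · exact Or.inr ⟨h2, h1, h3⟩
  · exact Or.inl ⟨h2, h1, h3⟩

theorem hplus_reach_skew (E : V → V → Prop) {p q : V × V}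
    (h : Relation.ReflTransGen (HPlusArc E) p q) :
    Relation.ReflTransGen (HPlusArc E) q.swap p.swap := by
  induction h with
  | refl => exact .refl
  | tail _ h ih => exact .head (hplus_skew E h) ih

theorem coupled_coupled (C : Set (V × V)) : CoupledSet (CoupledSet C) = C := rfl

theorem coupled_scc (E : V → V → Prop) {D : Set (V × V)} (h : IsSCC (HPlusArc E) D) :
    IsSCC (HPlusArc E) (CoupledSet D) := by
  obtain ⟨a, rfl⟩ := h
  refine ⟨a.swap, ?_⟩
  ext b
  constructor
  · rintro ⟨h1, h2⟩
    exact ⟨hplus_reach_skew E h2, hplus_reach_skew E h1⟩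
  · rintro ⟨h1, h2⟩
    exact ⟨hplus_reach_skew E h2, hplus_reach_skew E h1⟩

theorem scc_eq_of_mem {α : Type*} {R : α → α → Prop} {A B : Set α} (hA : IsSCC R A)
    (hB : IsSCC R B) {p q : α} (hp : p ∈ A) (hq : q ∈ B) (h1 : Relation.ReflTransGen R p q)
    (h2 : Relation.ReflTransGen R q p) : A = B := by
  obtain ⟨a, rfl⟩ := hA
  obtain ⟨b, rfl⟩ := hB
  ext x
  constructor
  · rintro ⟨h3, h4⟩
    exact ⟨hq.1.trans (h2.trans (hp.2.trans h3)), h4.trans (hp.1.trans (h1.trans hq.2))⟩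
  · rintro ⟨h3, h4⟩
    exact ⟨hp.1.trans (h1.trans (hq.2.trans h3)), h4.trans (hq.1.trans (h2.trans hp.2))⟩

theorem scc_reach {α : Type*} {R : α → α → Prop} {A : Set α} (hA : IsSCC R A) {p q : α}
    (hp : p ∈ A) (hq : q ∈ A) : Relation.ReflTransGen R p q := by
  obtain ⟨a, rfl⟩ := hA
  exact hp.2.trans hq.1

/-- The strong components of `H⁺` that are neither special nor co-special are even in
number, say `2k`, and can be enumerated as `C₁, …, C_{2k}` so that the coupled component
of `Cᵢ` is `C_{2k+1-i}` and every arc of `H⁺` between distinct components of the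
enumeration goes from a smaller index to a larger one. -/
theorem topological_sort_of_nonspecial_components {V : Type*} [Fintype V]
    (E : V → V → Prop) :
    ∃ (k : ℕ) (C : Fin (2 * k) → Set (V × V)),
      Function.Injective C ∧
      (∀ D : Set (V × V),
        (IsSCC (HPlusArc E) D ∧ ¬ SpecialComp E D ∧ ¬ CoSpecialComp E D) ↔ ∃ i, C i = D) ∧
      (∀ i : Fin (2 * k), CoupledSet (C i) = C (Fin.rev i)) ∧
      (∀ i j : Fin (2 * k), C i ≠ C j →
        (∃ p ∈ C i, ∃ q ∈ C j, HPlusArc E p q) → i < j) := by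
  classical
  let S : Set (Set (V × V)) :=
    {D | IsSCC (HPlusArc E) D ∧ ¬ SpecialComp E D ∧ ¬ CoSpecialComp E D}
  have hSfin : S.Finite := Set.toFinite S
  let r : Set (V × V) → Set (V × V) → Prop :=
    fun A B => A ≠ B ∧ ∃ p ∈ A, ∃ q ∈ B, HPlusArc E p q
  let dn : Set (V × V) → Set (V × V) :=
    fun A => {p | ∃ q ∈ A, Relation.ReflTransGen (HPlusArc E) p q}
  obtain ⟨k, l, hlen, hnd, hmem, hmap, hpw⟩ := list_sort_aux r (fun A => (dn A).ncard)
    (CoupledSet (V := V)) coupled_coupled _ hSfin.toFinset rfl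
    (by
      intro a ha
      rw [Set.Finite.mem_toFinset] at ha ⊢
      exact ⟨coupled_scc E ha.1, ha.2.2, ha.2.1⟩)
    (by
      intro a ha h
      rw [Set.Finite.mem_toFinset] at ha
      refine ha.2.1 fun p hp => ?_
      have hp2 : (p.2, p.1) ∈ a := by rw [← h]; exact hp
      exact scc_reach ha.1 hp hp2)
    (by
      rintro a ha b hb ⟨hne, p, hp, q, hq, hpq⟩
      rw [Set.Finite.mem_toFinset] at ha hb
      apply Set.ncard_lt_ncard _ (Set.toFinite _)
      refine ⟨?_, fun hsub => hne ?_⟩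
      · rintro x ⟨y, hy, hxy⟩
        exact ⟨q, hq, (hxy.trans (scc_reach ha.1 hy hp)).tail hpq⟩
      · obtain ⟨y, hy, hqy⟩ := hsub (show q ∈ dn b from ⟨q, hq, .refl⟩)
        exact scc_eq_of_mem ha.1 hb.1 hp hq (.single hpq) (hqy.trans (scc_reach ha.1 hy hp)))
    (by
      rintro a ha b hb ⟨hne, p, hp, q, hq, hpq⟩
      refine ⟨fun h => hne ?_, q.swap, hq, p.swap, hp, hplus_skew E hpq⟩
      rw [← coupled_coupled a, ← h, coupled_coupled])
  have hlt : ∀ i : Fin (2 * k), (i : ℕ) < l.length := fun i => by rw [hlen]; exact i.2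
  refine ⟨k, fun i => l[(i : ℕ)]'(hlt i), ?_, ?_, ?_, ?_⟩
  · intro i j hij
    exact Fin.ext ((hnd.getElem_inj_iff).1 hij)
  · intro D
    have h1 := hmem D
    rw [Set.Finite.mem_toFinset] at h1
    refine Iff.trans (Iff.symm h1) ?_
    rw [List.mem_iff_getElem]
    constructor
    · rintro ⟨i, hi, h⟩
      exact ⟨⟨i, by omega⟩, h⟩
    · rintro ⟨i, h⟩
      exact ⟨i, hlt i, h⟩
  · intro i
    have h1 : (l.map (CoupledSet (V := V)))[(i : ℕ)]'(by simpa using hlt i)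
        = l.reverse[(i : ℕ)]'(by simpa using hlt i) := by simp only [hmap]
    rw [List.getElem_map, List.getElem_reverse] at h1
    rw [h1]
    congr 1
    simp only [Fin.val_rev]
    omega
  · intro i j hne hex
    by_contra hij
    rcases lt_or_eq_of_le (not_lt.1 hij) with h | h
    · exact (List.pairwise_iff_getElem.1 hpw j i (hlt j) (hlt i) h) ⟨hne, hex⟩
    · subst h
      exact hne rfl
end

section
/- Let H be a digraph and let u, v, w together with witnesses s(u), b(u), s(v), b(v), s(w), b(w) form a DAT in H. Then there is a single strong component C of H^+ containing all of the pairs (u,v), (v,u), (u,w), (w,u), (v,w), (w,v), (s(u),b(u)), (s(v),b(v)), (s(w),b(w)); in particular, all of these pairs are invertible pairs of H. Moreover, for each choice of x ∈ {u,v,w} with {y,z} = {u,v,w}∖{x}, the witnessing walks P(x,s(x)), P(y,b(x)), P(z,b(x)) can be chosen so that the associated directed walks in H^+ from (x,y) to (s(x),b(x)) and from (x,z) to (s(x),b(x)) lie entirely inside C. -/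
variable {V : Type*}

/-- `x 0, x 1, ..., x n` is a walk in the digraph `E` with pattern `ε`:
step `i` is a forward arc if `ε i = true` and a backward arc if `ε i = false`.
Two walks are congruent iff they have the same length `n` and the same pattern `ε`. -/
def IsWalkOn (E : V → V → Prop) (n : ℕ) (x : ℕ → V) (ε : ℕ → Bool) : Prop :=
  ∀ i < n, if ε i = true then E (x i) (x (i + 1)) else E (x (i + 1)) (x i)

/-- The walk `x` avoids the congruent walk `y` (common pattern `ε`, length `n`):
there is no arc from `x i` to `y (i+1)` in the direction of step `i`. -/
def AvoidsOn (E : V → V → Prop) (n : ℕ) (x y : ℕ → V) (ε : ℕ → Bool) : Prop :=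
  ∀ i < n, if ε i = true then ¬ E (x i) (y (i + 1)) else ¬ E (y (i + 1)) (x i)

/-- `u, v` is an invertible pair: there are congruent walks `P : u → v`, `Q : v → u`
with `P` avoiding `Q`, and congruent walks `P' : v → u`, `Q' : u → v` with `P'`
avoiding `Q'`. -/
def InvertiblePair (E : V → V → Prop) (u v : V) : Prop :=
  (∃ (n : ℕ) (x y : ℕ → V) (ε : ℕ → Bool),
      IsWalkOn E n x ε ∧ IsWalkOn E n y ε ∧
      x 0 = u ∧ x n = v ∧ y 0 = v ∧ y n = u ∧ AvoidsOn E n x y ε) ∧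
  (∃ (n : ℕ) (x y : ℕ → V) (ε : ℕ → Bool),
      IsWalkOn E n x ε ∧ IsWalkOn E n y ε ∧
      x 0 = v ∧ x n = u ∧ y 0 = u ∧ y n = v ∧ AvoidsOn E n x y ε)

/-- The witnessing condition of a permutable triple, for the vertex `x` of the triple
`x, y, z`: there are mutually congruent walks `P : x → sx`, `Q : y → bx`, `R : z → bx`
such that `P` avoids both `Q` and `R`. -/
def TripleWitness (E : V → V → Prop) (x y z sx bx : V) : Prop :=
  ∃ (n : ℕ) (ε : ℕ → Bool) (P Q R : ℕ → V),
    IsWalkOn E n P ε ∧ IsWalkOn E n Q ε ∧ IsWalkOn E n R ε ∧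
    P 0 = x ∧ P n = sx ∧ Q 0 = y ∧ Q n = bx ∧ R 0 = z ∧ R n = bx ∧
    AvoidsOn E n P Q ε ∧ AvoidsOn E n P R ε

/-- `u, v, w` (distinct) form a permutable triple with witnesses
`su, bu, sv, bv, sw, bw`. -/
def PermutableWitnesses (E : V → V → Prop) (u v w su bu sv bv sw bw : V) : Prop :=
  u ≠ v ∧ u ≠ w ∧ v ≠ w ∧
  TripleWitness E u v w su bu ∧ TripleWitness E v u w sv bv ∧ TripleWitness E w u v sw bw

/-- `H` has a permutable triple. -/
def HasPermutableTriple (E : V → V → Prop) : Prop :=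
  ∃ u v w su bu sv bv sw bw : V, PermutableWitnesses E u v w su bu sv bv sw bw

/-- A digraph asteroidal triple (DAT): a permutable triple in which each of the
three pairs `(su,bu)`, `(sv,bv)`, `(sw,bw)` is invertible. -/
def IsDAT (E : V → V → Prop) (u v w su bu sv bv sw bw : V) : Prop :=
  PermutableWitnesses E u v w su bu sv bv sw bw ∧
  InvertiblePair E su bu ∧ InvertiblePair E sv bv ∧ InvertiblePair E sw bw

/-- `H` is DAT-free. -/
def DATFree (E : V → V → Prop) : Prop :=
  ¬ ∃ u v w su bu sv bv sw bw : V, IsDAT E u v w su bu sv bv sw bw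

/-- `TripleWitness` whose two associated directed walks in `H⁺` lie inside `C`. -/
def TripleWitnessIn (E : V → V → Prop) (C : Set (V × V)) (x y z sx bx : V) : Prop :=
  ∃ (n : ℕ) (ε : ℕ → Bool) (P Q R : ℕ → V),
    IsWalkOn E n P ε ∧ IsWalkOn E n Q ε ∧ IsWalkOn E n R ε ∧
    P 0 = x ∧ P n = sx ∧ Q 0 = y ∧ Q n = bx ∧ R 0 = z ∧ R n = bx ∧
    AvoidsOn E n P Q ε ∧ AvoidsOn E n P R ε ∧
    (∀ i ≤ n, (P i, Q i) ∈ C) ∧ (∀ i ≤ n, (P i, R i) ∈ C)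

theorem hplus_swap {E : V → V → Prop} {p q : V × V} (h : HPlusArc E p q) :
    HPlusArc E q.swap p.swap := by
  rcases h with ⟨h1, h2, h3⟩ | ⟨h1, h2, h3⟩
  · exact Or.inr ⟨h2, h1, h3⟩
  · exact Or.inl ⟨h2, h1, h3⟩

theorem reach_swap {E : V → V → Prop} {p q : V × V}
    (h : Relation.ReflTransGen (HPlusArc E) p q) :
    Relation.ReflTransGen (HPlusArc E) q.swap p.swap := by
  induction h with
  | refl => exact .refl
  | tail _ h2 ih => exact .head (hplus_swap h2) ih

theorem walk_arc {E : V → V → Prop} {n : ℕ} {x y : ℕ → V} {ε : ℕ → Bool}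
    (hx : IsWalkOn E n x ε) (hy : IsWalkOn E n y ε) (ha : AvoidsOn E n x y ε)
    (i : ℕ) (hi : i < n) : HPlusArc E (x i, y i) (x (i + 1), y (i + 1)) := by
  have h1 := hx i hi
  have h2 := hy i hi
  have h3 := ha i hi
  by_cases he : ε i = true
  · simp only [he, if_true] at h1 h2 h3
    exact Or.inl ⟨h1, h2, h3⟩
  · simp only [he] at h1 h2 h3
    exact Or.inr ⟨h1, h2, h3⟩

theorem walk_reach {E : V → V → Prop} {n : ℕ} {x y : ℕ → V} {ε : ℕ → Bool}
    (hx : IsWalkOn E n x ε) (hy : IsWalkOn E n y ε) (ha : AvoidsOn E n x y ε)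
    (i j : ℕ) (hij : i ≤ j) (hj : j ≤ n) :
    Relation.ReflTransGen (HPlusArc E) (x i, y i) (x j, y j) := by
  induction j, hij using Nat.le_induction with
  | base => exact .refl
  | succ k hk ih => exact .tail (ih (by omega)) (walk_arc hx hy ha k (by omega))

/-- A directed walk in the pair digraph comes from congruent avoiding walks. -/
theorem reach_walk {E : V → V → Prop} {p q : V × V}
    (h : Relation.ReflTransGen (HPlusArc E) p q) :
    ∃ (n : ℕ) (x y : ℕ → V) (ε : ℕ → Bool),
      IsWalkOn E n x ε ∧ IsWalkOn E n y ε ∧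
      x 0 = p.1 ∧ x n = q.1 ∧ y 0 = p.2 ∧ y n = q.2 ∧ AvoidsOn E n x y ε := by
  induction h using Relation.ReflTransGen.head_induction_on with
  | refl =>
    exact ⟨0, fun _ => q.1, fun _ => q.2, fun _ => true, fun i hi => absurd hi (by omega),
      fun i hi => absurd hi (by omega), rfl, rfl, rfl, rfl, fun i hi => absurd hi (by omega)⟩
  | @head a c hac _ ih =>
    obtain ⟨n, x, y, ε, hx, hy, x0, xn, y0, yn, ha⟩ := ih
    have key : ∃ b : Bool, (if b = true then E a.1 (x 0) else E (x 0) a.1) ∧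
        (if b = true then E a.2 (y 0) else E (y 0) a.2) ∧
        (if b = true then ¬ E a.1 (y 0) else ¬ E (y 0) a.1) := by
      rw [x0, y0]
      rcases hac with ⟨h1, h2, h3⟩ | ⟨h1, h2, h3⟩
      · exact ⟨true, by simpa using h1, by simpa using h2, by simpa using h3⟩
      · exact ⟨false, by simpa using h1, by simpa using h2, by simpa using h3⟩
    obtain ⟨b, k1, k2, k3⟩ := key
    refine ⟨n + 1, fun i => Nat.casesOn i a.1 x, fun i => Nat.casesOn i a.2 y,
      fun i => Nat.casesOn i b ε, ?_, ?_, rfl, xn, rfl, yn, ?_⟩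
    · intro i hi
      cases i with
      | zero => exact k1
      | succ i => exact hx i (by omega)
    · intro i hi
      cases i with
      | zero => exact k2
      | succ i => exact hy i (by omega)
    · intro i hi
      cases i with
      | zero => exact k3
      | succ i => exact ha i (by omega)

theorem invertible_iff {E : V → V → Prop} {a b : V} :
    InvertiblePair E a b ↔ InSameSCC (HPlusArc E) (a, b) (b, a) := by
  constructor
  · rintro ⟨⟨n, x, y, ε, hx, hy, x0, xn, y0, yn, ha⟩, ⟨m, x', y', ε', hx', hy', x0', xm', y0', ym', ha'⟩⟩
    have h1 := walk_reach hx hy ha 0 n (by omega) le_rfl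
    have h2 := walk_reach hx' hy' ha' 0 m (by omega) le_rfl
    rw [x0, xn, y0, yn] at h1
    rw [x0', xm', y0', ym'] at h2
    exact ⟨h1, h2⟩
  · rintro ⟨h1, h2⟩
    exact ⟨reach_walk h1, reach_walk h2⟩

theorem witness_reach {E : V → V → Prop} {x y z s b : V} (h : TripleWitness E x y z s b) :
    Relation.ReflTransGen (HPlusArc E) (x, y) (s, b) ∧
    Relation.ReflTransGen (HPlusArc E) (x, z) (s, b) := by
  obtain ⟨n, ε, P, Q, R, hP, hQ, hR, P0, Pn, Q0, Qn, R0, Rn, hPQ, hPR⟩ := h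
  have h1 := walk_reach hP hQ hPQ 0 n (by omega) le_rfl
  have h2 := walk_reach hP hR hPR 0 n (by omega) le_rfl
  rw [P0, Pn, Q0, Qn] at h1
  rw [P0, Pn, R0, Rn] at h2
  exact ⟨h1, h2⟩

theorem witness_in {E : V → V → Prop} {x y z s b : V} {a : V × V}
    (h : TripleWitness E x y z s b)
    (h1 : Relation.ReflTransGen (HPlusArc E) a (x, y))
    (h2 : Relation.ReflTransGen (HPlusArc E) a (x, z))
    (h3 : Relation.ReflTransGen (HPlusArc E) (s, b) a) :
    TripleWitnessIn E {c | InSameSCC (HPlusArc E) a c} x y z s b := by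
  obtain ⟨n, ε, P, Q, R, hP, hQ, hR, P0, Pn, Q0, Qn, R0, Rn, hPQ, hPR⟩ := h
  refine ⟨n, ε, P, Q, R, hP, hQ, hR, P0, Pn, Q0, Qn, R0, Rn, hPQ, hPR, ?_, ?_⟩
  · intro i hi
    have k1 := walk_reach hP hQ hPQ 0 i (by omega) hi
    have k2 := walk_reach hP hQ hPQ i n hi le_rfl
    rw [P0, Q0] at k1
    rw [Pn, Qn] at k2
    exact ⟨h1.trans k1, k2.trans h3⟩
  · intro i hi
    have k1 := walk_reach hP hR hPR 0 i (by omega) hi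
    have k2 := walk_reach hP hR hPR i n hi le_rfl
    rw [P0, R0] at k1
    rw [Pn, Rn] at k2
    exact ⟨h2.trans k1, k2.trans h3⟩

theorem witness_back {E : V → V → Prop} {x y z s b : V} (h : TripleWitness E x y z s b)
    (hi : InvertiblePair E s b) :
    Relation.ReflTransGen (HPlusArc E) (s, b) (y, x) ∧
    Relation.ReflTransGen (HPlusArc E) (s, b) (z, x) := by
  obtain ⟨h1, h2⟩ := witness_reach h
  have k := (invertible_iff.1 hi).1
  exact ⟨k.trans (reach_swap h1), k.trans (reach_swap h2)⟩

/-- If `u, v, w` (with witnesses) is a DAT, then all six pairs of triple vertices and all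
three pairs `(s(x),b(x))` lie in one strong component `C` of `H⁺` (hence all are
invertible), and the witnessing walks can be chosen so that the associated directed
walks in `H⁺` lie entirely inside `C`. -/
theorem dat_all_in_one_component (E : V → V → Prop) (u v w su bu sv bv sw bw : V)
    (h : IsDAT E u v w su bu sv bv sw bw) :
    ∃ C : Set (V × V), IsSCC (HPlusArc E) C ∧
      (u, v) ∈ C ∧ (v, u) ∈ C ∧ (u, w) ∈ C ∧ (w, u) ∈ C ∧ (v, w) ∈ C ∧ (w, v) ∈ C ∧
      (su, bu) ∈ C ∧ (sv, bv) ∈ C ∧ (sw, bw) ∈ C ∧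
      InvertiblePair E u v ∧ InvertiblePair E v u ∧ InvertiblePair E u w ∧
      InvertiblePair E w u ∧ InvertiblePair E v w ∧ InvertiblePair E w v ∧
      InvertiblePair E su bu ∧ InvertiblePair E sv bv ∧ InvertiblePair E sw bw ∧
      TripleWitnessIn E C u v w su bu ∧ TripleWitnessIn E C v u w sv bv ∧
      TripleWitnessIn E C w u v sw bw := by
  obtain ⟨⟨-, -, -, hu, hv, hw⟩, iu, iv, iw⟩ := h
  obtain ⟨u1, u2⟩ := witness_reach hu
  obtain ⟨u3, u4⟩ := witness_back hu iu
  obtain ⟨v1, v2⟩ := witness_reach hv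
  obtain ⟨v3, v4⟩ := witness_back hv iv
  obtain ⟨w1, w2⟩ := witness_reach hw
  obtain ⟨w3, w4⟩ := witness_back hw iw
  -- reachability from `(u, v)`
  have a_su := u1
  have a_vu := u1.trans u3
  have a_wu := u1.trans u4
  have a_sv := a_vu.trans v1
  have a_wv := a_sv.trans v4
  have a_sw := a_wu.trans w1
  have a_uw := a_sw.trans w3
  have a_vw := a_sw.trans w4
  -- reachability to `(u, v)`
  have b_sv := v3
  have b_vu := v1.trans b_sv
  have b_vw := v2.trans b_sv
  have b_su := u3.trans b_vu
  have b_uw := u2.trans b_su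
  have b_sw := w4.trans b_vw
  have b_wu := w1.trans b_sw
  have b_wv := w2.trans b_sw
  have iuv : InvertiblePair E u v := invertible_iff.2 ⟨a_vu, b_vu⟩
  have iuw : InvertiblePair E u w := invertible_iff.2 ⟨b_uw.trans a_wu, b_wu.trans a_uw⟩
  have ivw : InvertiblePair E v w := invertible_iff.2 ⟨b_vw.trans a_wv, b_wv.trans a_vw⟩
  exact ⟨{c | InSameSCC (HPlusArc E) (u, v) c}, ⟨_, rfl⟩, ⟨.refl, .refl⟩, ⟨a_vu, b_vu⟩,
    ⟨a_uw, b_uw⟩, ⟨a_wu, b_wu⟩, ⟨a_vw, b_vw⟩, ⟨a_wv, b_wv⟩, ⟨a_su, b_su⟩, ⟨a_sv, b_sv⟩,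
    ⟨a_sw, b_sw⟩, iuv, iuv.symm, iuw, iuw.symm, ivw, ivw.symm, iu, iv, iw,
    witness_in hu .refl a_uw b_su, witness_in hv a_vu a_vw b_sv, witness_in hw a_wu a_wv b_sw⟩
end
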